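/- For every positive integer r, if H is the vertex-disjoint union of r triangles (so |V(H)| = 3r), then there is an absolute constant c such that every graph of treewidth at least c·r·log₂(r+1) contains H as a minor. -/

import Mathlib

open SimpleGraph
variable {V : Type}

/-- `G` has a tree decomposition of width at most `w`. -/
def HasTreeDecompWidth (G : SimpleGraph V) (w : ℕ) : Prop :=
  ∃ (ι : Type) (T : SimpleGraph ι) (bag : ι → Set V),
    T.IsTree ∧
    (∀ v, ∃ i, v ∈ bag i) ∧
    (∀ u v, G.Adj u v → ∃ i, u ∈ bag i ∧ v ∈ bag i) ∧
    (∀ v, (T.induce {i | v ∈ bag i}).Connected) ∧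
    (∀ i, (bag i).Finite ∧ (bag i).ncard ≤ w + 1)

/-- The treewidth of `G`. -/
noncomputable def treewidth (G : SimpleGraph V) : ℕ := sInf {w | HasTreeDecompWidth G w}

/-- `H` is a minor of `G`, via branch sets. -/
def IsMinor {W : Type*} (H : SimpleGraph W) (G : SimpleGraph V) : Prop :=
  ∃ φ : W → Set V, (∀ w, (φ w).Nonempty ∧ (G.induce (φ w)).Connected) ∧
    (∀ w w', w ≠ w' → Disjoint (φ w) (φ w')) ∧
    (∀ w w', H.Adj w w' → ∃ u ∈ φ w, ∃ v ∈ φ w', G.Adj u v)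

/-- `H` is the disjoint union of `r` cycles, each of length at most `ℓ`. -/
def IsDisjointUnionOfCycles {W : Type*} (H : SimpleGraph W) (r ℓ : ℕ) : Prop :=
  ∃ f : Fin r → Σ v, H.Walk v v,
    (∀ i, (f i).2.IsCycle ∧ (f i).2.length ≤ ℓ) ∧
    (∀ i j, i ≠ j → ∀ x ∈ (f i).2.support, x ∉ (f j).2.support) ∧
    (∀ w : W, ∃ i, w ∈ (f i).2.support) ∧
    (∀ e ∈ H.edgeSet, ∃ i, e ∈ (f i).2.edges)

section Helpers
open Classical

/-- `S` is nonempty and every vertex of `S` has two neighbours in `S`. -/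
def Cyc (G : SimpleGraph V) (S : Finset V) : Prop :=
  S.Nonempty ∧ ∀ v ∈ S, ∃ a ∈ S, ∃ b ∈ S, a ≠ b ∧ G.Adj v a ∧ G.Adj v b

theorem Cyc.mono {F G : SimpleGraph V} (h : F ≤ G) {S : Finset V} (hS : Cyc F S) : Cyc G S :=
  ⟨hS.1, fun v hv => by
    obtain ⟨a, ha, b, hb, hab, h1, h2⟩ := hS.2 v hv
    exact ⟨a, ha, b, hb, hab, h h1, h h2⟩⟩

theorem not_acyclic_of_two {U : Type} [Fintype U] [Nonempty U] (G : SimpleGraph U)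
    (h : ∀ v, ∃ a b, a ≠ b ∧ G.Adj v a ∧ G.Adj v b) : ¬ G.IsAcyclic := by
  intro hG
  let P : ℕ → Prop := fun n => ∃ (u v : U) (p : G.Walk u v), p.IsPath ∧ p.length = n
  have hP0 : P 0 := ⟨Classical.arbitrary U, _, Walk.nil, by simp, rfl⟩
  have hmax := Nat.findGreatest_spec (P := P) (Nat.zero_le (Fintype.card U)) hP0
  obtain ⟨u, v, p, hp, hl⟩ := hmax
  have key : ∀ a, G.Adj u a → a = p.snd := by
    intro a ha
    have hmem : a ∈ p.support := by
      by_contra hn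
      have hq : (Walk.cons ha.symm p).IsPath := by
        rw [Walk.cons_isPath_iff]; exact ⟨hp, hn⟩
      have h1 := hq.length_lt
      have h2 : (Walk.cons ha.symm p).length ≤ Nat.findGreatest P (Fintype.card U) :=
        Nat.le_findGreatest h1.le ⟨_, _, _, hq, rfl⟩
      simp at h2
      omega
    exact hG.eq_snd_of_adj_start hp ha hmem
  obtain ⟨a, b, hab, ha, hb⟩ := h u
  exact hab ((key a ha).trans (key b hb).symm)

theorem Cyc.exists_cycle {G : SimpleGraph V} {S : Finset V} (hS : Cyc G S) :
    ∃ (u : V) (p : G.Walk u u), p.IsCycle ∧ ∀ x ∈ p.support, x ∈ S := by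
  have : Nonempty S := hS.1.to_subtype
  have hna : ¬ (G.induce (S : Set V)).IsAcyclic := by
    apply not_acyclic_of_two (U := S)
    rintro ⟨v, hv⟩
    obtain ⟨a, ha, b, hb, hab, h1, h2⟩ := hS.2 v hv
    exact ⟨⟨a, ha⟩, ⟨b, hb⟩, by simpa using hab, h1, h2⟩
  unfold SimpleGraph.IsAcyclic at hna
  push Not at hna
  obtain ⟨u, p, hp⟩ := hna
  refine ⟨_, p.map (Embedding.induce (G := G) (S : Set V)).toHom, ?_, ?_⟩
  · exact hp.map (Embedding.induce (G := G) (S : Set V)).injective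
  · intro x hx
    rw [Walk.support_map] at hx
    obtain ⟨y, _, rfl⟩ := List.mem_map.1 hx
    exact y.2

/-- three pairwise adjacent disjoint connected sets inside `S` -/
theorem Cyc.exists_triangle {G : SimpleGraph V} {S : Finset V} (hS : Cyc G S) :
    ∃ B : Fin 3 → Set V, (∀ j, (B j).Nonempty ∧ (G.induce (B j)).Connected ∧ B j ⊆ S) ∧
      (∀ i j, i ≠ j → Disjoint (B i) (B j)) ∧
      (∀ i j, i ≠ j → ∃ u ∈ B i, ∃ v ∈ B j, G.Adj u v) := by
  obtain ⟨u, p, hp, hsub⟩ := hS.exists_cycle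
  have hlen := hp.three_le_length
  match p, hp, hsub, hlen with
  | .cons (v := v1) h1 (.cons (v := v2) h2 (.cons (v := v3) h3 q)), hp, hsub, hlen =>
    rw [Walk.cons_isCycle_iff] at hp
    obtain ⟨hp, _⟩ := hp
    rw [Walk.cons_isPath_iff, Walk.cons_isPath_iff] at hp
    obtain ⟨⟨_, hv2⟩, hv1⟩ := hp
    simp only [Walk.support_cons, List.mem_cons, not_or] at hv1 hsub
    have hc : (G.induce {x | x ∈ q.support}).Connected := q.connected_induce_support
    refine ⟨![{v1}, {v2}, {x | x ∈ q.support}], ?_, ?_, ?_⟩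
    · intro j
      fin_cases j
      · refine ⟨⟨v1, rfl⟩, ?_, ?_⟩
        · simp
        · intro x hx
          obtain rfl : x = v1 := hx
          exact hsub x (by simp)
      · refine ⟨⟨v2, rfl⟩, ?_, ?_⟩
        · simp
        · intro x hx
          obtain rfl : x = v2 := hx
          exact hsub x (by simp)
      · exact ⟨⟨v3, q.start_mem_support⟩, hc, fun x hx => hsub x (by right; right; right; exact hx)⟩
    · have d01 : Disjoint ({v1} : Set V) {v2} := by simpa using hv1.1
      have d02 : Disjoint ({v1} : Set V) {x | x ∈ q.support} := by simpa using hv1.2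
      have d12 : Disjoint ({v2} : Set V) {x | x ∈ q.support} := by simpa using hv2
      intro i j hij
      fin_cases i <;> fin_cases j <;>
        first
        | exact absurd rfl hij | exact d01 | exact d02 | exact d12 | exact d01.symm
        | exact d02.symm | exact d12.symm
    · have a1 : v3 ∈ q.support := q.start_mem_support
      have a0 : u ∈ q.support := q.end_mem_support
      intro i j hij
      fin_cases i <;> fin_cases j <;>
        first
        | exact absurd rfl hij
        | exact ⟨v1, rfl, v2, rfl, h2⟩
        | exact ⟨v2, rfl, v1, rfl, h2.symm⟩
        | exact ⟨v2, rfl, v3, a1, h3⟩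
        | exact ⟨v3, a1, v2, rfl, h3.symm⟩
        | exact ⟨v1, rfl, u, a0, h1.symm⟩
        | exact ⟨u, a0, v1, rfl, h1⟩

/-- disjoint cyclic sets give the minor -/
theorem minor_of_cyc {W : Type} (H : SimpleGraph W) (G : SimpleGraph V) (r : ℕ)
    (hH : IsDisjointUnionOfCycles H r 3) (S : Fin r → Finset V) (hS : ∀ i, Cyc G (S i))
    (hd : ∀ i j, i ≠ j → Disjoint (S i) (S j)) : IsMinor H G := by
  obtain ⟨f, hf, hdis, hcov, hedge⟩ := hH
  choose B hB1 hB2 hB3 using fun i => (hS i).exists_triangle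
  choose comp hcomp using hcov
  have hcu : ∀ w i, w ∈ (f i).2.support → comp w = i := by
    intro w i hw
    by_contra hne
    exact hdis _ _ hne w (hcomp w) hw
  have hinj : ∀ i, ∃ g : W → Fin 3, ∀ w ∈ (f i).2.support, ∀ w' ∈ (f i).2.support,
      g w = g w' → w = w' := by
    intro i
    have hcard : ((f i).2.support.toFinset).card ≤ 3 := by
      have h1 : (f i).2.support.toFinset ⊆ (f i).2.support.tail.toFinset := by
        intro x hx
        rw [List.mem_toFinset] at hx ⊢
        rcases (f i).2.mem_support_iff.1 hx with rfl | h
        · exact Walk.end_mem_tail_support (hf i).1.not_nil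
        · exact h
      have h2 := Finset.card_le_card h1
      have h3 := List.toFinset_card_le (f i).2.support.tail
      have h4 := (f i).2.length_support
      have h5 := (hf i).2
      simp only [List.length_tail] at h3
      omega
    obtain ⟨g, hg⟩ : ∃ g : ((f i).2.support.toFinset) → Fin 3, Function.Injective g := by
      have : Nonempty (((f i).2.support.toFinset) ↪ Fin 3) := by
        apply Function.Embedding.nonempty_of_card_le
        rw [Fintype.card_coe, Fintype.card_fin]; exact hcard
      exact ⟨this.some, this.some.injective⟩
    refine ⟨fun w => if h : w ∈ (f i).2.support.toFinset then g ⟨w, h⟩ else 0, ?_⟩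
    intro w hw w' hw' he
    have e1 : w ∈ (f i).2.support.toFinset := by simpa using hw
    have e2 : w' ∈ (f i).2.support.toFinset := by simpa using hw'
    simp only [e1, e2, dif_pos] at he
    simpa using hg he
  choose g hg using hinj
  refine ⟨fun w => B (comp w) (g (comp w) w), ?_, ?_, ?_⟩
  · intro w
    exact ⟨(hB1 _ _).1, (hB1 _ _).2.1⟩
  · intro w w' hne
    by_cases hc : comp w = comp w'
    · show Disjoint (B (comp w) (g (comp w) w)) (B (comp w') (g (comp w') w'))
      rw [← hc]
      apply hB2
      intro he
      exact hne (hg _ w (hcomp w) w' (hc ▸ hcomp w') he)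
    · exact Set.disjoint_of_subset (hB1 _ _).2.2 (hB1 _ _).2.2
        (Finset.disjoint_coe.2 (hd _ _ hc))
  · intro w w' ha
    obtain ⟨i, hi⟩ := hedge s(w, w') ha
    have m1 := (f i).2.fst_mem_support_of_mem_edges hi
    have m2 := (f i).2.snd_mem_support_of_mem_edges hi
    have c1 := hcu _ _ m1
    have c2 := hcu _ _ m2
    show ∃ u ∈ B (comp w) (g (comp w) w), ∃ v ∈ B (comp w') (g (comp w') w'), G.Adj u v
    rw [c1, c2]
    apply hB3
    intro he
    exact ha.ne (hg i w m1 w' m2 he)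

/-- add a leaf to a graph -/
def addLeaf {ι : Type} (T : SimpleGraph ι) (i0 : ι) : SimpleGraph (Option ι) :=
  T.map Function.Embedding.some ⊔ edge none (some i0)

theorem addLeaf_some {ι : Type} (T : SimpleGraph ι) (i0 : ι) {a b : ι} (h : T.Adj a b) :
    (addLeaf T i0).Adj (some a) (some b) :=
  Or.inl ((map_adj_apply (f := Function.Embedding.some)).2 h)

theorem addLeaf_none {ι : Type} (T : SimpleGraph ι) (i0 : ι) :
    (addLeaf T i0).Adj none (some i0) := by
  right
  simp [edge_adj]

theorem addLeaf_isTree {ι : Type} (T : SimpleGraph ι) (hT : T.IsTree) (i0 : ι) :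
    (addLeaf T i0).IsTree := by
  constructor
  · have hr : ∀ x, (addLeaf T i0).Reachable (some i0) x := by
      rintro (_ | x)
      · exact (addLeaf_none T i0).reachable.symm
      · have h := hT.1.preconnected i0 x
        let f : T →g addLeaf T i0 := ⟨some, fun h => addLeaf_some T i0 h⟩
        exact h.map f
    have : Nonempty (Option ι) := ⟨none⟩
    exact ⟨fun x y => (hr x).symm.trans (hr y)⟩
  · apply IsAcyclic.sup_edge_of_not_reachable
    · rintro ⟨p⟩
      cases p with
      | cons h q => 
        obtain ⟨a, b, _, h1, _⟩ := (map_adj _ _ _ _).1 h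
        simp at h1
    · rw [isAcyclic_iff_forall_adj_isBridge]
      intro x y hxy
      obtain ⟨a, b, hab, rfl, rfl⟩ := (map_adj _ _ _ _).1 hxy
      have hb := (isAcyclic_iff_forall_adj_isBridge.1 hT.2) hab
      rw [isBridge_iff] at hb ⊢
      intro hr
      apply hb
      let f : (T.map Function.Embedding.some).deleteEdges
          {s(Function.Embedding.some a, Function.Embedding.some b)} →g T.deleteEdges {s(a, b)} :=
        ⟨fun o => o.getD i0, by
          intro x y h
          rw [deleteEdges_adj] at h ⊢
          obtain ⟨h, hn⟩ := h
          obtain ⟨c, d, hcd, rfl, rfl⟩ := (map_adj _ _ _ _).1 h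
          refine ⟨hcd, fun he => hn ?_⟩
          simpa using he⟩
      exact hr.map f

theorem forest_decomp (G : SimpleGraph V) (n : ℕ) : ∀ A : Finset V, A.card = n →
    (∀ S ⊆ A, ¬ Cyc G S) →
    ∃ (ι : Type) (T : SimpleGraph ι) (b : ι → Finset V), T.IsTree ∧
      (∀ v ∈ A, ∃ i, v ∈ b i) ∧
      (∀ u ∈ A, ∀ v ∈ A, G.Adj u v → ∃ i, u ∈ b i ∧ v ∈ b i) ∧
      (∀ v ∈ A, (T.induce {i | v ∈ b i}).Connected) ∧
      (∀ i, b i ⊆ A) ∧ (∀ i, (b i).card ≤ 2) := by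
  induction n with
  | zero =>
    intro A hA _
    obtain rfl := Finset.card_eq_zero.1 hA
    exact ⟨Unit, ⊥, fun _ => ∅, IsTree.of_subsingleton, by simp, by simp, by simp, by simp, by simp⟩
  | succ n ih =>
    intro A hA hcyc
    have hne : A.Nonempty := by rw [← Finset.card_pos]; omega
    have h1 : ∃ v ∈ A, ∀ a ∈ A, ∀ b ∈ A, G.Adj v a → G.Adj v b → a = b := by
      by_contra hcon
      push Not at hcon
      apply hcyc A subset_rfl
      refine ⟨hne, fun v hv => ?_⟩
      obtain ⟨a, ha, b, hb, h1, h2, h3⟩ := hcon v hv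
      exact ⟨a, ha, b, hb, h3, h1, h2⟩
    obtain ⟨v, hv, hv1⟩ := h1
    obtain ⟨ι, T, b, hT, hc, he, hcon, hsub, hcard⟩ := ih (A.erase v)
      (by rw [Finset.card_erase_of_mem hv, hA]; rfl)
      (fun S hS => hcyc S (hS.trans (Finset.erase_subset _ _)))
    have hvb : ∀ i, v ∉ b i := fun i hi => by simpa using hsub i hi
    obtain ⟨i0, N, hN, hNsub, hNi, hNcov⟩ : ∃ (i0 : ι) (N : Finset V), N.card ≤ 1 ∧ N ⊆ A.erase v ∧
        (∀ u ∈ N, u ∈ b i0) ∧ (∀ u ∈ A, G.Adj v u → u ∈ N) := by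
      by_cases hu : ∃ u ∈ A, G.Adj v u
      · obtain ⟨u, hu, hvu⟩ := hu
        have hu' : u ∈ A.erase v := Finset.mem_erase.2 ⟨hvu.ne', hu⟩
        obtain ⟨i, hi⟩ := hc u hu'
        refine ⟨i, {u}, by simp, by simpa using hu', by simpa using hi, ?_⟩
        intro w hw hvw
        simpa using hv1 w hw u hu hvw hvu
      · push Not at hu
        obtain ⟨i⟩ := hT.1.nonempty
        exact ⟨i, ∅, by simp, by simp, by simp, fun u h1 h2 => absurd h2 (hu u h1)⟩
    have hvN : v ∉ N := fun h => by simpa using hNsub h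
    refine ⟨Option ι, addLeaf T i0, fun o => o.elim (insert v N) b, addLeaf_isTree T hT i0,
      ?_, ?_, ?_, ?_, ?_⟩
    · intro w hw
      by_cases hwv : w = v
      · exact ⟨none, by simp [hwv]⟩
      · obtain ⟨i, hi⟩ := hc w (Finset.mem_erase.2 ⟨hwv, hw⟩)
        exact ⟨some i, hi⟩
    · intro x hx y hy hxy
      by_cases hxv : x = v
      · subst hxv
        exact ⟨none, by simp, by simp [hNcov y hy hxy]⟩
      · by_cases hyv : y = v
        · subst hyv
          exact ⟨none, by simp [hNcov x hx hxy.symm], by simp⟩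
        · obtain ⟨i, hi⟩ := he x (Finset.mem_erase.2 ⟨hxv, hx⟩) y (Finset.mem_erase.2 ⟨hyv, hy⟩) hxy
          exact ⟨some i, hi⟩
    · intro w hw
      by_cases hwv : w = v
      · have : {o : Option ι | w ∈ o.elim (insert v N) b} = {none} := by
          ext o
          cases o with
          | none => simp [hwv]
          | some i => simpa [hwv] using hvb i
        rw [this]
        simp
      · have hwc := hcon w (Finset.mem_erase.2 ⟨hwv, hw⟩)
        obtain ⟨i1, hi1⟩ := hc w (Finset.mem_erase.2 ⟨hwv, hw⟩)
        let f : T.induce {i | w ∈ b i} →g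
            (addLeaf T i0).induce {o : Option ι | w ∈ o.elim (insert v N) b} :=
          ⟨fun x => ⟨some x.1, x.2⟩, fun h => addLeaf_some T i0 h⟩
        have hr : ∀ x : {o : Option ι | w ∈ o.elim (insert v N) b},
            ((addLeaf T i0).induce {o : Option ι | w ∈ o.elim (insert v N) b}).Reachable
              ⟨some i1, hi1⟩ x := by
          rintro ⟨(_ | i), hx⟩
          · have hwN : w ∈ N := by simpa [hwv] using hx
            have r1 := (hwc.preconnected ⟨i1, hi1⟩ ⟨i0, hNi w hwN⟩).map f
            refine r1.trans (Adj.reachable ?_)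
            exact (addLeaf_none T i0).symm
          · exact (hwc.preconnected ⟨i1, hi1⟩ ⟨i, hx⟩).map f
        have : Nonempty {o : Option ι | w ∈ o.elim (insert v N) b} := ⟨⟨some i1, hi1⟩⟩
        exact ⟨fun x y => (hr x).symm.trans (hr y)⟩
    · rintro (_ | i)
      · intro x hx
        rcases Finset.mem_insert.1 hx with rfl | h
        · exact hv
        · exact Finset.mem_of_mem_erase (hNsub h)
      · exact (hsub i).trans (Finset.erase_subset _ _)
    · rintro (_ | i)
      · exact (Finset.card_insert_le _ _).trans (by omega)
      · exact hcard i

theorem decomp_of_fvs [Fintype V] (G : SimpleGraph V) (X : Finset V)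
    (h : ∀ S, Disjoint S X → ¬ Cyc G S) : HasTreeDecompWidth G (X.card + 1) := by
  obtain ⟨ι, T, b, hT, hc, he, hcon, hsub, hcard⟩ := forest_decomp G _ (Finset.univ \ X) rfl
    (fun S hS => h S (Finset.disjoint_of_subset_left hS Finset.sdiff_disjoint))
  refine ⟨ι, T, fun i => (X ∪ b i : Finset V), hT, ?_, ?_, ?_, ?_⟩
  · intro v
    by_cases hv : v ∈ X
    · obtain ⟨i⟩ := hT.1.nonempty
      exact ⟨i, by simp [hv]⟩
    · obtain ⟨i, hi⟩ := hc v (by simp [hv])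
      exact ⟨i, by simp [hi]⟩
  · intro u v huv
    by_cases hu : u ∈ X
    · by_cases hv : v ∈ X
      · obtain ⟨i⟩ := hT.1.nonempty
        exact ⟨i, by simp [hu], by simp [hv]⟩
      · obtain ⟨i, hi⟩ := hc v (by simp [hv])
        exact ⟨i, by simp [hu], by simp [hi]⟩
    · by_cases hv : v ∈ X
      · obtain ⟨i, hi⟩ := hc u (by simp [hu])
        exact ⟨i, by simp [hi], by simp [hv]⟩
      · obtain ⟨i, hi, hj⟩ := he u (by simp [hu]) v (by simp [hv]) huv
        exact ⟨i, by simp [hi], by simp [hj]⟩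
  · intro v
    by_cases hv : v ∈ X
    · have : {i | v ∈ ((X ∪ b i : Finset V) : Set V)} = Set.univ := by
        ext i; simp [hv]
      rw [this]
      exact (induceUnivIso T).connected_iff.2 hT.1
    · have : {i | v ∈ ((X ∪ b i : Finset V) : Set V)} = {i | v ∈ b i} := by
        ext i; simp [hv]
      rw [this]
      exact hcon v (by simp [hv])
  · intro i
    refine ⟨Finset.finite_toSet _, ?_⟩
    rw [Set.ncard_coe_finset]
    have := Finset.card_union_le X (b i)
    have := hcard i
    omega

/-- the degree -/
noncomputable def dg [Fintype V] (F : SimpleGraph V) (v : V) : ℕ :=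
  (Finset.univ.filter (fun w => F.Adj v w)).card

theorem path_set (F : SimpleGraph V) (d : V → ℕ) (R : V → Prop)
    (hpar : ∀ x, R x → d x ≠ 0 → ∃ y, R y ∧ F.Adj x y ∧ d y + 1 = d x)
    (hzero : ∀ x y, R x → R y → d x = 0 → d y = 0 → x = y) (n : ℕ) :
    ∀ a b, R a → R b → a ≠ b → d a + d b = n →
    ∃ Q : Finset V, a ∈ Q ∧ b ∈ Q ∧ Q.card ≤ 1 + n ∧
      (∀ x ∈ Q, x ≠ a → x ≠ b → d x < max (d a) (d b) ∧
        ∃ y ∈ Q, ∃ z ∈ Q, y ≠ z ∧ F.Adj x y ∧ F.Adj x z) ∧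
      (∃ y ∈ Q, F.Adj a y) ∧ (∃ y ∈ Q, F.Adj b y) := by
  induction n with
  | zero =>
    intro a b ha hb hab h
    exact absurd (hzero a b ha hb (by omega) (by omega)) hab
  | succ n ih =>
    have main : ∀ a b, R a → R b → a ≠ b → d b ≤ d a → d a + d b = n + 1 →
        ∃ Q : Finset V, a ∈ Q ∧ b ∈ Q ∧ Q.card ≤ 1 + (n + 1) ∧
        (∀ x ∈ Q, x ≠ a → x ≠ b → d x < max (d a) (d b) ∧
          ∃ y ∈ Q, ∃ z ∈ Q, y ≠ z ∧ F.Adj x y ∧ F.Adj x z) ∧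
        (∃ y ∈ Q, F.Adj a y) ∧ (∃ y ∈ Q, F.Adj b y) := by
      intro a b ha hb hab hle hn
      obtain ⟨p, hp, hap, hdp⟩ := hpar a ha (by omega)
      by_cases hpb : p = b
      · subst hpb
        refine ⟨{a, p}, by simp, by simp, ?_, ?_, ⟨p, by simp, hap⟩, ⟨a, by simp, hap.symm⟩⟩
        · exact Finset.card_le_two.trans (by omega)
        · intro x hx h1 h2
          simp at hx
          tauto
      · obtain ⟨Q, hpQ, hbQ, hc, hin, ⟨y, hy, hpy⟩, ⟨z, hz, hbz⟩⟩ := ih p b hp hb hpb (by omega)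
        have haQ : a ∉ Q := by
          intro h
          by_cases h1 : a = p
          · exact hap.ne h1
          · have := (hin a h h1 hab).1
            have h3 : max (d p) (d b) ≤ d a := max_le (by omega) hle
            omega
        refine ⟨insert a Q, by simp, by simp [hbQ], ?_, ?_, ⟨p, by simp [hpQ], hap⟩,
          ⟨z, by simp [hz], hbz⟩⟩
        · rw [Finset.card_insert_of_notMem haQ]; omega
        · intro x hx hxa hxb
          have hxQ : x ∈ Q := by simpa [hxa] using hx
          rw [max_eq_left hle]
          by_cases hxp : x = p
          · subst hxp
            refine ⟨by omega, a, by simp, y, by simp [hy], ?_, hap.symm, hpy⟩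
            rintro rfl
            exact haQ hy
          · obtain ⟨h1, y', hy', z', hz', h2, h3, h4⟩ := hin x hxQ hxp hxb
            refine ⟨lt_of_lt_of_le h1 (max_le (by omega) hle), y', by simp [hy'], z',
              by simp [hz'], h2, h3, h4⟩
    intro a b ha hb hab hn
    rcases le_total (d b) (d a) with h | h
    · exact main a b ha hb hab h hn
    · obtain ⟨Q, h1, h2, h3, h4, h5, h6⟩ := main b a hb ha hab.symm h (by omega)
      refine ⟨Q, h2, h1, h3, fun x hx hxa hxb => ?_, h6, h5⟩
      rw [max_comm]
      exact h4 x hx hxb hxa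

theorem moore [Fintype V] (F : SimpleGraph V) (p : ℕ) (v0 : V) (hv0 : dg F v0 ≠ 0)
    (hdeg : ∀ v, dg F v ≠ 0 → 3 ≤ dg F v)
    (hN : (Finset.univ.filter (fun v => 3 ≤ dg F v)).card < 2 ^ p) :
    ∃ S, Cyc F S ∧ S.card ≤ 2 * p + 2 := by
  by_contra hcon
  push Not at hcon
  let d : V → ℕ := fun x => F.dist v0 x
  let R : V → Prop := fun x => F.Reachable v0 x
  have hpar : ∀ x, R x → d x ≠ 0 → ∃ y, R y ∧ F.Adj x y ∧ d y + 1 = d x := by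
    intro x hx hdx
    obtain ⟨w, hw⟩ := Reachable.exists_walk_length_eq_dist hx.symm
    cases w with
    | nil => simp [d] at hdx
    | cons h q =>
      rename_i y
      have hy : R y := hx.trans h.reachable
      refine ⟨y, hy, h, ?_⟩
      have h1 : F.dist y v0 ≤ q.length := dist_le q
      simp only [Walk.length_cons] at hw
      have h2 : F.dist x v0 ≤ F.dist y v0 + 1 := by
        obtain ⟨w', hw'⟩ := Reachable.exists_walk_length_eq_dist hy.symm
        have := dist_le (Walk.cons h w')
        simp only [Walk.length_cons] at this
        omega
      simp only [d, dist_comm (u := v0)]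
      omega
  have hstep : ∀ x y, R x → F.Adj x y → R y ∧ d y ≤ d x + 1 := by
    intro x y hx hxy
    refine ⟨hx.trans hxy.reachable, ?_⟩
    obtain ⟨w, hw⟩ := Reachable.exists_walk_length_eq_dist hx
    have := dist_le (w.concat hxy)
    simp only [Walk.length_concat] at this
    simp only [d]
    omega
  have hz : ∀ x, R x → d x = 0 → x = v0 := fun x hx h =>
    ((Reachable.dist_eq_zero_iff hx).1 h).symm
  have hzero : ∀ x y, R x → R y → d x = 0 → d y = 0 → x = y := fun x y hx hy h1 h2 =>
    (hz x hx h1).trans (hz y hy h2).symm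
  have hdegR : ∀ x, R x → 3 ≤ dg F x := by
    intro x hx
    by_cases h : d x = 0
    · rw [hz x hx h]; exact hdeg _ hv0
    · obtain ⟨y, _, hxy, _⟩ := hpar x hx h
      apply hdeg
      have : y ∈ Finset.univ.filter (fun w => F.Adj x w) := by simpa using hxy
      exact Finset.card_ne_zero_of_mem this
  have huniq : ∀ w a b, R w → d w ≤ p → F.Adj w a → F.Adj w b → d a ≤ d w → d b ≤ d w →
      a = b := by
    intro w a b hw hwp hwa hwb ha hb
    by_contra hab
    obtain ⟨Q, haQ, hbQ, hc, hin, ⟨y, hy, hay⟩, ⟨z, hz', hbz⟩⟩ := path_set F d R hpar hzero _ a b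
      (hstep w a hw hwa).1 (hstep w b hw hwb).1 hab rfl
    have hwQ : w ∉ Q := by
      intro h
      have := (hin w h hwa.ne hwb.ne).1
      have h3 : max (d a) (d b) ≤ d w := max_le ha hb
      omega
    have hcyc : Cyc F (insert w Q) := by
      refine ⟨⟨w, by simp⟩, ?_⟩
      intro x hx
      by_cases hxw : x = w
      · subst hxw
        exact ⟨a, by simp [haQ], b, by simp [hbQ], hab, hwa, hwb⟩
      have hxQ : x ∈ Q := by simpa [hxw] using hx
      by_cases hxa : x = a
      · subst hxa
        exact ⟨w, by simp, y, by simp [hy], fun h => hwQ (h ▸ hy), hwa.symm, hay⟩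
      by_cases hxb : x = b
      · subst hxb
        exact ⟨w, by simp, z, by simp [hz'], fun h => hwQ (h ▸ hz'), hwb.symm, hbz⟩
      obtain ⟨_, y', hy', z', hz', h2, h3, h4⟩ := hin x hxQ hxa hxb
      exact ⟨y', by simp [hy'], z', by simp [hz'], h2, h3, h4⟩
    have := hcon _ hcyc
    rw [Finset.card_insert_of_notMem hwQ] at this
    omega
  let sph : ℕ → Finset V := fun j => Finset.univ.filter (fun x => R x ∧ d x = j)
  have hgrow : ∀ j, j ≤ p → 2 ^ j ≤ (sph j).card := by
    intro j
    induction j with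
    | zero =>
      intro _
      have : v0 ∈ sph 0 := by simp [sph, R, d]
      simpa using Finset.card_pos.2 ⟨v0, this⟩
    | succ j ih =>
      intro hj
      have h1 := ih (by omega)
      have h2 := Finset.card_mul_le_card_mul (s := sph j) (t := sph (j + 1)) (m := 2) (n := 1)
        F.Adj ?_ ?_
      · rw [pow_succ]; omega
      · intro u hu
        simp only [sph, Finset.mem_filter, Finset.mem_univ, true_and] at hu
        have h3 := hdegR u hu.1
        have h4 : (Finset.univ.filter (fun w => F.Adj u w ∧ d w ≤ d u)).card ≤ 1 := by
          rw [Finset.card_le_one]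
          intro a ha b hb
          simp only [Finset.mem_filter, Finset.mem_univ, true_and] at ha hb
          exact huniq u a b hu.1 (by omega) ha.1 hb.1 ha.2 hb.2
        have h5 : Finset.univ.filter (fun w => F.Adj u w) ⊆
            Finset.univ.filter (fun w => F.Adj u w ∧ d w ≤ d u) ∪
              Finset.bipartiteAbove F.Adj (sph (j + 1)) u := by
          intro w hw
          simp only [Finset.mem_filter, Finset.mem_univ, true_and] at hw
          obtain ⟨h6, h7⟩ := hstep u w hu.1 hw
          simp only [Finset.mem_union, Finset.mem_filter, Finset.mem_univ, true_and,
            Finset.mem_bipartiteAbove, sph]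
          by_cases h8 : d w ≤ d u
          · exact Or.inl ⟨hw, h8⟩
          · exact Or.inr ⟨⟨h6, by omega⟩, hw⟩
        have h6 := (Finset.card_le_card h5).trans (Finset.card_union_le _ _)
        unfold dg at h3
        omega
      · intro w hw
        simp only [sph, Finset.mem_filter, Finset.mem_univ, true_and] at hw
        rw [Finset.card_le_one]
        intro a ha b hb
        simp only [Finset.mem_bipartiteBelow, sph, Finset.mem_filter, Finset.mem_univ,
          true_and] at ha hb
        exact huniq w a b hw.1 (by omega) ha.2.symm hb.2.symm (by omega) (by omega)
  have hfin := hgrow p le_rfl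
  have hsub : sph p ⊆ Finset.univ.filter (fun v => 3 ≤ dg F v) := by
    intro x hx
    simp only [sph, Finset.mem_filter, Finset.mem_univ, true_and] at hx ⊢
    exact hdegR x hx.1
  have := Finset.card_le_card hsub
  omega

theorem short_cycle [Fintype V] (p : ℕ) (n : ℕ) : ∀ (F : SimpleGraph V),
    (Finset.univ.filter (fun v => dg F v = 2)).card = n →
    (∃ v, dg F v ≠ 0) → (∀ v, dg F v ≠ 1) →
    (Finset.univ.filter (fun v => 3 ≤ dg F v)).card < 2 ^ p →
    ∃ S, Cyc F S ∧ (S.filter (fun v => 3 ≤ dg F v)).card ≤ 2 * p + 2 := by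
  induction n with
  | zero =>
    intro F hn ⟨v0, hv0⟩ h1 hN
    rw [Finset.card_eq_zero, Finset.filter_eq_empty_iff] at hn
    obtain ⟨S, hS, hc⟩ := moore F p v0 hv0 (fun v hv => by
      have := hn (Finset.mem_univ v)
      have := h1 v
      omega) hN
    exact ⟨S, hS, (Finset.card_filter_le _ _).trans hc⟩
  | succ n ih =>
    intro F hn _ h1 hN
    have : (Finset.univ.filter (fun v => dg F v = 2)).Nonempty := by
      rw [← Finset.card_pos]; omega
    obtain ⟨v, hv⟩ := this
    simp only [Finset.mem_filter, Finset.mem_univ, true_and] at hv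
    obtain ⟨a, b, hab, hvab⟩ := Finset.card_eq_two.1 hv
    have hadj : ∀ w, F.Adj v w ↔ w = a ∨ w = b := by
      intro w
      have : w ∈ Finset.univ.filter (fun w => F.Adj v w) ↔ w ∈ ({a, b} : Finset V) := by rw [hvab]
      simpa using this
    have hva : F.Adj v a := (hadj a).2 (Or.inl rfl)
    have hvb : F.Adj v b := (hadj b).2 (Or.inr rfl)
    by_cases hFab : F.Adj a b
    · refine ⟨{v, a, b}, ⟨⟨v, by simp⟩, ?_⟩, ?_⟩
      · intro x hx
        simp only [Finset.mem_insert, Finset.mem_singleton] at hx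
        rcases hx with rfl | rfl | rfl
        · exact ⟨a, by simp, b, by simp, hab, hva, hvb⟩
        · exact ⟨v, by simp, b, by simp, hvb.ne, hva.symm, hFab⟩
        · exact ⟨v, by simp, a, by simp, hva.ne, hvb.symm, hFab.symm⟩
      · have : ({v, a, b} : Finset V).filter (fun v => 3 ≤ dg F v) ⊆ {a, b} := by
          intro x hx
          simp only [Finset.mem_filter, Finset.mem_insert, Finset.mem_singleton] at hx ⊢
          rcases hx.1 with rfl | h
          · omega
          · exact h
        have := Finset.card_le_card this
        have := Finset.card_le_two (a := a) (b := b)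
        omega
    · obtain ⟨F', hF'⟩ : ∃ F' : SimpleGraph V, ∀ x y, F'.Adj x y ↔
          x ≠ v ∧ y ≠ v ∧ (F.Adj x y ∨ (x = a ∧ y = b) ∨ (x = b ∧ y = a)) := ⟨
        { Adj := fun x y => x ≠ v ∧ y ≠ v ∧ (F.Adj x y ∨ (x = a ∧ y = b) ∨ (x = b ∧ y = a))
          symm := ⟨by
            rintro x y ⟨h1, h2, h3⟩
            refine ⟨h2, h1, ?_⟩
            rcases h3 with h | ⟨rfl, rfl⟩ | ⟨rfl, rfl⟩
            · exact Or.inl h.symm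
            · exact Or.inr (Or.inr ⟨rfl, rfl⟩)
            · exact Or.inr (Or.inl ⟨rfl, rfl⟩)⟩
          loopless := ⟨by
            rintro x ⟨h1, h2, h3⟩
            rcases h3 with h | ⟨rfl, h⟩ | ⟨rfl, h⟩
            · exact F.loopless.irrefl x h
            · exact hab h
            · exact hab h.symm⟩ }, fun x y => Iff.rfl⟩
      have hFv : dg F' v = 0 := by
        unfold dg
        rw [Finset.card_eq_zero, Finset.filter_eq_empty_iff]
        intro w _ h
        exact ((hF' _ _).1 h).1 rfl
      have aux : ∀ x y, F.Adj v x → F.Adj v y → x ≠ y → ¬ F.Adj x y →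
          (∀ w, F'.Adj x w ↔ w ≠ v ∧ (F.Adj x w ∨ w = y)) → dg F' x = dg F x := by
        intro x y hx hy hxy hnxy hh
        unfold dg
        have e : Finset.univ.filter (fun w => F'.Adj x w) =
            insert y ((Finset.univ.filter (fun w => F.Adj x w)).erase v) := by
          ext w
          simp only [Finset.mem_filter, Finset.mem_univ, true_and, hh, Finset.mem_insert,
            Finset.mem_erase]
          constructor
          · tauto
          · rintro (rfl | h)
            · exact ⟨hy.ne', Or.inr rfl⟩
            · tauto
        rw [e, Finset.card_insert_of_notMem (by simp [hnxy]), Finset.card_erase_of_mem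
          (by simpa using hx.symm)]
        have : 0 < (Finset.univ.filter (fun w => F.Adj x w)).card :=
          Finset.card_pos.2 ⟨v, by simpa using hx.symm⟩
        omega
      have hdg : ∀ x, x ≠ v → dg F' x = dg F x := by
        intro x hxv
        by_cases hxa : x = a
        · subst hxa
          apply aux x b hva hvb hab hFab
          intro w
          rw [hF']
          constructor
          · rintro ⟨_, h2, h | h | h⟩
            · exact ⟨h2, Or.inl h⟩
            · exact ⟨h2, Or.inr h.2⟩
            · exact absurd h.1 hab
          · rintro ⟨h2, h | h⟩
            · exact ⟨hxv, h2, Or.inl h⟩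
            · exact ⟨hxv, h2, Or.inr (Or.inl ⟨rfl, h⟩)⟩
        by_cases hxb : x = b
        · subst hxb
          apply aux x a hvb hva hab.symm (fun h => hFab h.symm)
          intro w
          rw [hF']
          constructor
          · rintro ⟨_, h2, h | h | h⟩
            · exact ⟨h2, Or.inl h⟩
            · exact absurd h.1.symm hab
            · exact ⟨h2, Or.inr h.2⟩
          · rintro ⟨h2, h | h⟩
            · exact ⟨hxv, h2, Or.inl h⟩
            · exact ⟨hxv, h2, Or.inr (Or.inr ⟨rfl, h⟩)⟩
        unfold dg
        congr 1
        ext w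
        simp only [Finset.mem_filter, Finset.mem_univ, true_and, hF']
        constructor
        · rintro ⟨_, _, h | h | h⟩
          · exact h
          · exact absurd h.1 hxa
          · exact absurd h.1 hxb
        · intro h
          refine ⟨hxv, ?_, Or.inl h⟩
          rintro rfl
          rcases (hadj x).1 h.symm with h | h
          · exact hxa h
          · exact hxb h
      have hle : ∀ x, 3 ≤ dg F' x ↔ 3 ≤ dg F x := by
        intro x
        by_cases hxv : x = v
        · subst hxv; omega
        · rw [hdg x hxv]
      obtain ⟨S, hS, hc⟩ := ih F' (by
          have : Finset.univ.filter (fun x => dg F' x = 2) =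
              (Finset.univ.filter (fun x => dg F x = 2)).erase v := by
            ext x
            simp only [Finset.mem_filter, Finset.mem_univ, true_and, Finset.mem_erase]
            by_cases hxv : x = v
            · subst hxv; simp [hFv]
            · simp [hdg x hxv, hxv]
          rw [this, Finset.card_erase_of_mem (by simpa using hv), hn]; rfl)
        ⟨a, by
          rw [hdg a hva.ne']
          exact Finset.card_ne_zero_of_mem (a := v) (by simpa using hva.symm)⟩
        (by
          intro x
          by_cases hxv : x = v
          · subst hxv; omega
          · rw [hdg x hxv]; exact h1 x)
        (by simpa only [hle] using hN)
      simp only [hle] at hc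
      have hvS : v ∉ S := by
        intro h
        obtain ⟨x, _, _, _, _, h2, _⟩ := hS.2 v h
        exact ((hF' _ _).1 h2).1 rfl
      by_cases hboth : a ∈ S ∧ b ∈ S
      · obtain ⟨haS, hbS⟩ := hboth
        refine ⟨insert v S, ⟨⟨v, by simp⟩, ?_⟩, ?_⟩
        · intro x hx
          by_cases hxv : x = v
          · subst hxv
            exact ⟨a, by simp [haS], b, by simp [hbS], hab, hva, hvb⟩
          have hxS : x ∈ S := by simpa [hxv] using hx
          obtain ⟨y, hy, z, hz, hyz, h2, h3⟩ := hS.2 x hxS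
          rw [hF'] at h2 h3
          obtain ⟨_, hyv, h2⟩ := h2
          obtain ⟨_, hzv, h3⟩ := h3
          have mv : v ∈ insert v S := by simp
          have my : y ∈ insert v S := by simp [hy]
          have mz : z ∈ insert v S := by simp [hz]
          rcases h2 with h2 | h2
          · rcases h3 with h3 | h3
            · exact ⟨y, my, z, mz, hyz, h2, h3⟩
            · refine ⟨y, my, v, mv, hyv, h2, ?_⟩
              rcases h3 with ⟨rfl, _⟩ | ⟨rfl, _⟩
              · exact hva.symm
              · exact hvb.symm
          · rcases h3 with h3 | h3
            · refine ⟨v, mv, z, mz, hzv.symm, ?_, h3⟩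
              rcases h2 with ⟨rfl, _⟩ | ⟨rfl, _⟩
              · exact hva.symm
              · exact hvb.symm
            · exfalso
              rcases h2 with ⟨rfl, rfl⟩ | ⟨rfl, rfl⟩ <;> rcases h3 with ⟨h4, rfl⟩ | ⟨h4, rfl⟩
              · exact hyz rfl
              · exact hab h4
              · exact hab h4.symm
              · exact hyz rfl
        · rw [Finset.filter_insert, if_neg (by omega)]
          exact hc
      · refine ⟨S, ⟨hS.1, ?_⟩, hc⟩
        intro x hxS
        obtain ⟨y, hy, z, hz, hyz, h2, h3⟩ := hS.2 x hxS
        have back : ∀ y ∈ S, F'.Adj x y → F.Adj x y := by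
          intro y hy h
          rcases ((hF' _ _).1 h).2.2 with h | ⟨rfl, rfl⟩ | ⟨rfl, rfl⟩
          · exact h
          · exact absurd ⟨hxS, hy⟩ hboth
          · exact absurd ⟨hy, hxS⟩ hboth
        exact ⟨y, hy, z, hz, hyz, back y hy h2, back z hz h3⟩

/-- weight of a degree -/
def wt : ℕ → ℤ
  | 0 => 0
  | n + 1 => n - 1

/-- twice the excess -/
noncomputable def Phi [Fintype V] (F : SimpleGraph V) : ℤ := ∑ v, wt (dg F v)

theorem wt_sub (d t : ℕ) : wt (d + t) - t ≤ wt d := by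
  cases d with
  | zero =>
    cases t with
    | zero => simp [wt]
    | succ t =>
      rw [Nat.zero_add]
      simp only [wt]
      push_cast
      omega
  | succ d =>
    have : d + 1 + t = (d + t) + 1 := by omega
    rw [this]
    simp only [wt]
    push_cast
    omega

theorem wt_two {d : ℕ} (h : 1 ≤ d) : wt d = d - 2 := by
  obtain ⟨n, rfl⟩ : ∃ n, d = n + 1 := ⟨d - 1, by omega⟩
  simp only [wt]
  push_cast
  ring

theorem dg_mono [Fintype V] {F G : SimpleGraph V} (h : F ≤ G) (v : V) : dg F v ≤ dg G v := by
  apply Finset.card_le_card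
  intro w
  simp only [Finset.mem_filter, Finset.mem_univ, true_and]
  exact fun hw => h hw

theorem del_edge [Fintype V] (F : SimpleGraph V) (u v : V) (h : F.Adj u v) :
    ∃ F' < F, Phi F' = Phi F + (wt (dg F u - 1) - wt (dg F u)) + (wt (dg F v - 1) - wt (dg F v)) := by
  obtain ⟨F', hF'⟩ : ∃ F' : SimpleGraph V, ∀ x y, F'.Adj x y ↔
      F.Adj x y ∧ ¬ (x = u ∧ y = v) ∧ ¬ (x = v ∧ y = u) := ⟨
    { Adj := fun x y => F.Adj x y ∧ ¬ (x = u ∧ y = v) ∧ ¬ (x = v ∧ y = u)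
      symm := ⟨fun x y hh => ⟨hh.1.symm, by tauto, by tauto⟩⟩
      loopless := ⟨fun x hh => F.loopless.irrefl x hh.1⟩ }, fun x y => Iff.rfl⟩
  have aux : ∀ x y, F.Adj x y → (∀ w, F'.Adj x w ↔ F.Adj x w ∧ w ≠ y) → dg F' x = dg F x - 1 := by
    intro x y hxy hh
    unfold dg
    have : Finset.univ.filter (fun w => F'.Adj x w) =
        (Finset.univ.filter (fun w => F.Adj x w)).erase y := by
      ext w
      simp only [Finset.mem_filter, Finset.mem_univ, true_and, hh, Finset.mem_erase]
      tauto
    rw [this, Finset.card_erase_of_mem (by simpa using hxy)]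
  have hne := h.ne
  have hu : dg F' u = dg F u - 1 := aux u v h (fun w => by
    rw [hF']
    constructor
    · rintro ⟨h1, h2, h3⟩
      exact ⟨h1, fun e => h2 ⟨rfl, e⟩⟩
    · rintro ⟨h1, h2⟩
      exact ⟨h1, fun e => h2 e.2, fun e => hne e.1⟩)
  have hv : dg F' v = dg F v - 1 := aux v u h.symm (fun w => by
    rw [hF']
    constructor
    · rintro ⟨h1, h2, h3⟩
      exact ⟨h1, fun e => h3 ⟨rfl, e⟩⟩
    · rintro ⟨h1, h2⟩
      exact ⟨h1, fun e => hne e.1.symm, fun e => h2 e.2⟩)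
  have ho : ∀ x, x ≠ u → x ≠ v → dg F' x = dg F x := by
    intro x hxu hxv
    unfold dg
    congr 1
    ext w
    simp only [Finset.mem_filter, Finset.mem_univ, true_and, hF']
    tauto
  refine ⟨F', ?_, ?_⟩
  · refine lt_of_le_of_ne (fun x y hh => ((hF' x y).1 hh).1) ?_
    rintro rfl
    exact ((hF' u v).1 h).2.1 ⟨rfl, rfl⟩
  · have hsum : ∑ x, (wt (dg F' x) - wt (dg F x)) =
        ∑ x ∈ ({u, v} : Finset V), (wt (dg F' x) - wt (dg F x)) := by
      symm
      apply Finset.sum_subset (Finset.subset_univ _)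
      intro x _ hx
      simp only [Finset.mem_insert, Finset.mem_singleton, not_or] at hx
      rw [ho x hx.1 hx.2, sub_self]
    rw [Finset.sum_pair hne, Finset.sum_sub_distrib, hu, hv] at hsum
    unfold Phi
    linarith

theorem prune [Fintype V] (F : SimpleGraph V) (M : ℤ) (hM : 0 ≤ M) (h : M ≤ Phi F) :
    ∃ F' ≤ F, M ≤ Phi F' ∧ Phi F' ≤ M + 1 ∧ ∀ v, dg F' v ≠ 1 := by
  obtain ⟨F', hmin⟩ := Set.Finite.exists_minimal (s := {F' : SimpleGraph V | F' ≤ F ∧ M ≤ Phi F'})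
    (Set.toFinite _) ⟨F, le_rfl, h⟩
  obtain ⟨⟨hle, hge⟩, hmin⟩ := hmin
  have hno : ∀ F'' < F', Phi F'' < M := by
    intro F'' hlt
    by_contra hcon
    push Not at hcon
    exact absurd (hmin ⟨hlt.le.trans hle, hcon⟩ hlt.le) (not_le_of_gt hlt)
  have hdrop : ∀ d : ℕ, 1 ≤ d → -1 ≤ wt (d - 1) - wt d := by
    intro d hd
    have := wt_sub (d - 1) 1
    rw [Nat.sub_add_cancel hd] at this
    push_cast at this
    linarith
  have hpos : ∀ u v, F'.Adj u v → 1 ≤ dg F' u := by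
    intro u v huv
    exact Finset.card_pos.2 ⟨v, by simpa using huv⟩
  refine ⟨F', hle, hge, ?_, ?_⟩
  · by_contra hcon
    push Not at hcon
    have hex : ∃ u v, F'.Adj u v := by
      by_contra hn
      push Not at hn
      have : Phi F' = 0 := by
        unfold Phi
        apply Finset.sum_eq_zero
        intro x _
        have : dg F' x = 0 := by
          unfold dg
          rw [Finset.card_eq_zero, Finset.filter_eq_empty_iff]
          intro w _
          exact hn x w
        rw [this]; rfl
      omega
    obtain ⟨u, v, huv⟩ := hex
    obtain ⟨F'', hlt, hPhi⟩ := del_edge F' u v huv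
    have h1 := hno F'' hlt
    have h2 := hdrop _ (hpos u v huv)
    have h3 := hdrop _ (hpos v u huv.symm)
    omega
  · intro u hu
    have hne : (Finset.univ.filter (fun w => F'.Adj u w)).Nonempty := by
      rw [← Finset.card_pos]
      change 0 < dg F' u
      omega
    obtain ⟨v, hv⟩ := hne
    have huv : F'.Adj u v := by simpa using hv
    obtain ⟨F'', hlt, hPhi⟩ := del_edge F' u v huv
    have h1 := hno F'' hlt
    have h3 := hdrop _ (hpos v u huv.symm)
    have hw : wt (dg F' u - 1) - wt (dg F' u) = 1 := by rw [hu]; rfl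
    omega

theorem remove_set [Fintype V] (F : SimpleGraph V) (h4 : ∀ v, dg F v ≤ 4)
    (S : Finset V) (hS : Cyc F S) (β : ℕ) (hβ : (S.filter (fun v => 3 ≤ dg F v)).card ≤ β) :
    ∃ F' ≤ F, Phi F - 4 * β ≤ Phi F' ∧ ∀ x y, F'.Adj x y → x ∉ S := by
  obtain ⟨F', hF'⟩ : ∃ F' : SimpleGraph V, ∀ x y, F'.Adj x y ↔
      F.Adj x y ∧ x ∉ S ∧ y ∉ S := ⟨
    { Adj := fun x y => F.Adj x y ∧ x ∉ S ∧ y ∉ S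
      symm := ⟨fun x y hh => ⟨hh.1.symm, by tauto, by tauto⟩⟩
      loopless := ⟨fun x hh => F.loopless.irrefl x hh.1⟩ }, fun x y => Iff.rfl⟩
  refine ⟨F', fun x y hh => ((hF' x y).1 hh).1, ?_, fun x y hh => ((hF' x y).1 hh).2.1⟩
  have hin : ∀ v ∈ S, dg F' v = 0 := by
    intro v hv
    unfold dg
    rw [Finset.card_eq_zero, Finset.filter_eq_empty_iff]
    intro w _ h
    exact ((hF' _ _).1 h).2.1 hv
  have hout : ∀ v ∈ S, (Finset.bipartiteAbove F.Adj Sᶜ v).card + 2 ≤ dg F v := by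
    intro v hv
    obtain ⟨a, ha, b, hb, hab, hva, hvb⟩ := hS.2 v hv
    have hd : Disjoint (Finset.bipartiteAbove F.Adj Sᶜ v) {a, b} := by
      rw [Finset.disjoint_left]
      intro x hx hx2
      simp only [Finset.mem_bipartiteAbove, Finset.mem_compl] at hx
      simp only [Finset.mem_insert, Finset.mem_singleton] at hx2
      rcases hx2 with rfl | rfl
      · exact hx.1 ha
      · exact hx.1 hb
    rw [← Finset.card_pair hab, ← Finset.card_union_of_disjoint hd]
    apply Finset.card_le_card
    intro x hx
    simp only [Finset.mem_union, Finset.mem_bipartiteAbove, Finset.mem_insert,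
      Finset.mem_singleton] at hx
    simp only [Finset.mem_filter, Finset.mem_univ, true_and]
    rcases hx with h | rfl | rfl
    · exact h.2
    · exact hva
    · exact hvb
  have hnot : ∀ v ∈ Sᶜ, wt (dg F v) - (Finset.bipartiteBelow F.Adj S v).card ≤ wt (dg F' v) := by
    intro v hv
    have hvS : v ∉ S := by simpa using hv
    have : dg F v = dg F' v + (Finset.bipartiteBelow F.Adj S v).card := by
      unfold dg
      rw [← Finset.card_union_of_disjoint]
      · congr 1
        ext w
        simp only [Finset.mem_filter, Finset.mem_univ, true_and, Finset.mem_union, hF',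
          Finset.mem_bipartiteBelow, F.adj_comm w v]
        tauto
      · rw [Finset.disjoint_left]
        intro w hw hw2
        simp only [Finset.mem_filter, Finset.mem_univ, true_and, hF',
          Finset.mem_bipartiteBelow] at hw hw2
        exact hw.2.2 hw2.1
    rw [this]
    exact wt_sub _ _
  have hdc := Finset.sum_card_bipartiteAbove_eq_sum_card_bipartiteBelow (s := S) (t := Sᶜ) F.Adj
  have e1 : Phi F = ∑ v ∈ S, wt (dg F v) + ∑ v ∈ Sᶜ, wt (dg F v) :=
    (Finset.sum_add_sum_compl S _).symm
  have e2 : Phi F' = ∑ v ∈ S, wt (dg F' v) + ∑ v ∈ Sᶜ, wt (dg F' v) :=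
    (Finset.sum_add_sum_compl S _).symm
  have e3 : ∑ v ∈ S, wt (dg F' v) = 0 :=
    Finset.sum_eq_zero (fun v hv => by rw [hin v hv]; rfl)
  have e4 : ∑ v ∈ Sᶜ, wt (dg F v) - ∑ v ∈ Sᶜ, ((Finset.bipartiteBelow F.Adj S v).card : ℤ) ≤
      ∑ v ∈ Sᶜ, wt (dg F' v) := by
    rw [← Finset.sum_sub_distrib]
    exact Finset.sum_le_sum hnot
  have e5 : ∑ v ∈ Sᶜ, ((Finset.bipartiteBelow F.Adj S v).card : ℤ) =
      ∑ v ∈ S, ((Finset.bipartiteAbove F.Adj Sᶜ v).card : ℤ) := by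
    exact_mod_cast hdc.symm
  have e6 : ∑ v ∈ S, (wt (dg F v) + ((Finset.bipartiteAbove F.Adj Sᶜ v).card : ℤ)) ≤
      ∑ v ∈ S, (if 3 ≤ dg F v then (4 : ℤ) else 0) := by
    apply Finset.sum_le_sum
    intro v hv
    have a1 := hout v hv
    have a2 := h4 v
    rw [wt_two (by omega)]
    split_ifs <;> omega
  have e7 : ∑ v ∈ S, (if 3 ≤ dg F v then (4 : ℤ) else 0) ≤ 4 * β := by
    rw [← Finset.sum_filter, Finset.sum_const, nsmul_eq_mul]
    have : ((S.filter (fun v => 3 ≤ dg F v)).card : ℤ) ≤ β := by exact_mod_cast hβ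
    linarith
  rw [Finset.sum_add_distrib] at e6
  linarith

theorem branch_le_Phi [Fintype V] (F : SimpleGraph V) (h1 : ∀ v, dg F v ≠ 1) :
    ((Finset.univ.filter (fun v => 3 ≤ dg F v)).card : ℤ) ≤ Phi F := by
  rw [Finset.card_filter]
  push_cast
  apply Finset.sum_le_sum
  intro v _
  have := h1 v
  by_cases h0 : dg F v = 0
  · rw [h0]; simp [wt]
  · rw [wt_two (by omega)]
    split_ifs <;> omega

theorem packing [Fintype V] (p K : ℕ) (hN : K * (8 * p + 8) + 1 < 2 ^ p) (k : ℕ) :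
    k ≤ K → ∀ F : SimpleGraph V, (∀ v, dg F v ≤ 4) → ((k * (8 * p + 8) : ℕ) : ℤ) ≤ Phi F →
    ∃ S : Fin k → Finset V, (∀ i, Cyc F (S i)) ∧ ∀ i j, i ≠ j → Disjoint (S i) (S j) := by
  induction k with
  | zero =>
    intro _ F _ _
    exact ⟨fun i => i.elim0, fun i => i.elim0, fun i => i.elim0⟩
  | succ k ih =>
    intro hk F h4 hPhi
    obtain ⟨F1, hle1, hP1, hP2, hd1⟩ := prune F _ (by positivity) hPhi
    have h41 : ∀ v, dg F1 v ≤ 4 := fun v => (dg_mono hle1 v).trans (h4 v)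
    have hbr := branch_le_Phi F1 hd1
    have hkK : (k + 1) * (8 * p + 8) ≤ K * (8 * p + 8) := Nat.mul_le_mul_right _ hk
    have hex : ∃ v, dg F1 v ≠ 0 := by
      by_contra hn
      push Not at hn
      have : Phi F1 = 0 := Finset.sum_eq_zero (fun v _ => by rw [hn v]; rfl)
      rw [this] at hP1
      have : 0 < (k + 1) * (8 * p + 8) := by positivity
      omega
    obtain ⟨S0, hS0, hc0⟩ := short_cycle p _ F1 rfl hex hd1 (by omega)
    obtain ⟨F2, hle2, hP3, hdis⟩ := remove_set F1 h41 S0 hS0 _ hc0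
    obtain ⟨S, hS, hd⟩ := ih (by omega) F2 (fun v => (dg_mono hle2 v).trans (h41 v)) (by
      push_cast at hP1 hP3 ⊢
      linarith)
    have hd0 : ∀ i, Disjoint S0 (S i) := by
      intro i
      rw [Finset.disjoint_right]
      intro x hx
      obtain ⟨a, _, _, _, _, ha, _⟩ := (hS i).2 x hx
      exact hdis x a ha
    refine ⟨Fin.cons S0 S, ?_, ?_⟩
    · intro i
      refine Fin.cases ?_ (fun i => ?_) i
      · exact hS0.mono hle1
      · exact (hS i).mono (hle2.trans hle1)
    · intro i j
      refine Fin.cases ?_ (fun i => ?_) i <;> refine Fin.cases ?_ (fun j => ?_) j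
      · intro h; exact absurd rfl h
      · intro _; exact hd0 j
      · intro _; exact (hd0 i).symm
      · intro h; exact hd i j (fun e => h (by rw [e]))

theorem dg_spanning_cycle [Fintype V] {G : SimpleGraph V} {u : V} (c : G.Walk u u)
    (hc : c.IsCycle) (R : SimpleGraph V) (hR : R = c.toSubgraph.spanningCoe) :
    (∀ x ∈ c.support, dg R x = 2) ∧ (∀ x, x ∉ c.support → dg R x = 0) ∧
      ∀ x y, R.Adj x y → x ∈ c.support := by
  have hsup : ∀ x y, R.Adj x y → x ∈ c.support := by
    intro x y h
    rw [hR, Subgraph.spanningCoe_adj] at h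
    exact c.mem_verts_toSubgraph.1 (c.toSubgraph.edge_vert h)
  refine ⟨?_, ?_, hsup⟩
  · intro x hx
    have h := hc.ncard_neighborSet_toSubgraph_eq_two hx
    rw [← h, dg, ← Set.ncard_coe_finset]
    congr 1
    ext w
    simp [hR]
  · intro x hx
    unfold dg
    rw [Finset.card_eq_zero, Finset.filter_eq_empty_iff]
    intro w _ h
    exact hx (hsup x w h)

theorem erdos_posa [Fintype V] (G : SimpleGraph V) (r p : ℕ) (hN : r * (8 * p + 8) + 1 < 2 ^ p) :
    (∃ S : Fin r → Finset V, (∀ i, Cyc G (S i)) ∧ ∀ i j, i ≠ j → Disjoint (S i) (S j)) ∨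
    ∃ X : Finset V, X.card ≤ r * (8 * p + 8) + r ∧ ∀ S, Disjoint S X → ¬ Cyc G S := by
  obtain ⟨H, hmax⟩ := Set.Finite.exists_maximal
    (s := {H : SimpleGraph V | H ≤ G ∧ ∀ v, dg H v ≠ 1 ∧ dg H v ≤ 4})
    (Set.toFinite _) ⟨⊥, bot_le, fun v => by
      have : dg (⊥ : SimpleGraph V) v = 0 := by simp [dg]
      omega⟩
  obtain ⟨⟨hle, hdeg⟩, hmax⟩ := hmax
  by_cases hPhi : ((r * (8 * p + 8) : ℕ) : ℤ) ≤ Phi H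
  · left
    obtain ⟨S, hS, hd⟩ := packing p r hN r le_rfl H (fun v => (hdeg v).2) hPhi
    exact ⟨S, fun i => (hS i).mono hle, hd⟩
  have hbr := branch_le_Phi H (fun v => (hdeg v).1)
  have : Fintype H.ConnectedComponent := Fintype.ofFinite _
  let D : Finset H.ConnectedComponent :=
    Finset.univ.filter (fun c => ∀ v, H.connectedComponentMk v = c → dg H v = 2)
  by_cases hD : r ≤ D.card
  · left
    have hemb : Nonempty (Fin r ↪ D) := by
      apply Function.Embedding.nonempty_of_card_le
      rw [Fintype.card_coe, Fintype.card_fin]; exact hD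
    obtain ⟨e⟩ := hemb
    refine ⟨fun i => Finset.univ.filter (fun v => H.connectedComponentMk v = (e i).1), ?_, ?_⟩
    · intro i
      have hi : ∀ v, H.connectedComponentMk v = (e i).1 → dg H v = 2 :=
        (Finset.mem_filter.1 (e i).2).2
      refine Cyc.mono hle ⟨?_, ?_⟩
      · obtain ⟨v, hv⟩ := (e i).1.exists_rep
        exact ⟨v, Finset.mem_filter.2 ⟨Finset.mem_univ _, hv⟩⟩
      · intro v hv
        have hv' : H.connectedComponentMk v = (e i).1 := by simpa using hv
        obtain ⟨a, b, hab, hvab⟩ := Finset.card_eq_two.1 (hi v hv')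
        have ha : H.Adj v a := by
          have : a ∈ Finset.univ.filter (fun w => H.Adj v w) := by rw [hvab]; simp
          simpa using this
        have hb : H.Adj v b := by
          have : b ∈ Finset.univ.filter (fun w => H.Adj v w) := by rw [hvab]; simp
          simpa using this
        refine ⟨a, ?_, b, ?_, hab, ha, hb⟩
        · simp only [Finset.mem_filter, Finset.mem_univ, true_and]
          rw [← hv']
          exact (ConnectedComponent.eq.2 ha.reachable).symm
        · simp only [Finset.mem_filter, Finset.mem_univ, true_and]
          rw [← hv']
          exact (ConnectedComponent.eq.2 hb.reachable).symm
    · intro i j hij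
      rw [Finset.disjoint_left]
      intro x hx hy
      simp only [Finset.mem_filter, Finset.mem_univ, true_and] at hx hy
      exact hij (e.injective (Subtype.ext (hx.symm.trans hy)))
  right
  choose rep hrep using fun c : H.ConnectedComponent => c.exists_rep
  refine ⟨Finset.univ.filter (fun v => 3 ≤ dg H v) ∪ D.image rep, ?_, ?_⟩
  · have h1 := Finset.card_union_le (Finset.univ.filter (fun v => 3 ≤ dg H v)) (D.image rep)
    have h2 := Finset.card_image_le (s := D) (f := rep)
    omega
  · intro S hSX hS
    obtain ⟨u, c, hc, hsub⟩ := hS.exists_cycle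
    obtain ⟨R, hR⟩ : ∃ R : SimpleGraph V, R = c.toSubgraph.spanningCoe := ⟨_, rfl⟩
    obtain ⟨hR2, hR0, hRs⟩ := dg_spanning_cycle c hc R hR
    have hRG : R ≤ G := by rw [hR]; exact c.toSubgraph.spanningCoe_le
    have hlow : ∀ x ∈ c.support, dg H x ≤ 2 := by
      intro x hx
      have h1 := Finset.disjoint_left.1 hSX (hsub x hx)
      simp only [Finset.mem_union, Finset.mem_filter, Finset.mem_univ, true_and, not_or] at h1
      omega
    have hRH : R ≤ H := by
      have : H ⊔ R ≤ H := by
        apply hmax _ le_sup_left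
        refine ⟨sup_le hle hRG, fun v => ?_⟩
        by_cases hv : v ∈ c.support
        · have a1 := dg_mono (le_sup_right : R ≤ H ⊔ R) v
          have a2 : dg (H ⊔ R) v ≤ dg H v + dg R v := by
            unfold dg
            refine le_trans (Finset.card_le_card ?_) (Finset.card_union_le _ _)
            intro w hw
            simpa using hw
          have a3 := hR2 v hv
          have a4 := hlow v hv
          omega
        · have : dg (H ⊔ R) v = dg H v := by
            unfold dg
            congr 1
            ext w
            simp only [Finset.mem_filter, Finset.mem_univ, true_and, sup_adj]
            exact ⟨fun h => h.resolve_right (fun h => hv (hRs v w h)), Or.inl⟩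
          rw [this]
          exact hdeg v
      exact le_sup_right.trans this
    have hclosed : ∀ x y, x ∈ c.support → H.Adj x y → y ∈ c.support := by
      intro x y hx hxy
      have e : Finset.univ.filter (fun w => R.Adj x w) = Finset.univ.filter (fun w => H.Adj x w) := by
        apply Finset.eq_of_subset_of_card_le
        · intro w hw
          simp only [Finset.mem_filter, Finset.mem_univ, true_and] at hw ⊢
          exact hRH hw
        · have a3 := hR2 x hx
          have a4 := hlow x hx
          unfold dg at a3 a4
          omega
      have : y ∈ Finset.univ.filter (fun w => R.Adj x w) := by rw [e]; simpa using hxy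
      have hyR : R.Adj x y := by simpa using this
      exact hRs y x hyR.symm
    have hwalk : ∀ x y, H.Walk x y → x ∈ c.support → y ∈ c.support := by
      intro x y w
      induction w with
      | nil => exact id
      | cons h _ ih => exact fun hx => ih (hclosed _ _ hx h)
    have hcomp : ∀ y, H.connectedComponentMk y = H.connectedComponentMk u → y ∈ c.support := by
      intro y hy
      obtain ⟨w⟩ := (ConnectedComponent.eq.1 hy).symm
      exact hwalk u y w c.start_mem_support
    have hDm : H.connectedComponentMk u ∈ D := by
      simp only [D, Finset.mem_filter, Finset.mem_univ, true_and]
      intro v hv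
      have hv' := hcomp v hv
      have a1 := dg_mono hRH v
      have a3 := hR2 v hv'
      have a4 := hlow v hv'
      omega
    have hrm : rep (H.connectedComponentMk u) ∈ c.support := hcomp _ (hrep _)
    apply Finset.disjoint_left.1 hSX (hsub _ hrm)
    exact Finset.mem_union_right _ (Finset.mem_image_of_mem _ hDm)

theorem numeric (r : ℕ) (hr : 0 < r) :
    r * (8 * (2 * (Nat.log 2 r + 1) + 8) + 8) + 1 < 2 ^ (2 * (Nat.log 2 r + 1) + 8) := by
  obtain ⟨q, hq⟩ : ∃ q, q = Nat.log 2 r + 1 := ⟨_, rfl⟩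
  rw [← hq]
  have h1 : r < 2 ^ q := by rw [hq]; exact Nat.lt_pow_succ_log_self (by norm_num) r
  have h2 : q < 2 ^ q := Nat.lt_two_pow_self
  have h3 : 2 ^ (2 * q + 8) = 256 * (2 ^ q * 2 ^ q) := by
    rw [pow_add, two_mul, pow_add]; ring
  rw [h3]
  nlinarith

theorem main_bound [Fintype V] (G : SimpleGraph V) (r : ℕ) (hr : 0 < r)
    (h : 200 * r * Real.logb 2 (r + 1) ≤ (treewidth G : ℝ)) :
    ∃ S : Fin r → Finset V, (∀ i, Cyc G (S i)) ∧ ∀ i j, i ≠ j → Disjoint (S i) (S j) := by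
  rcases erdos_posa G r _ (numeric r hr) with h1 | ⟨X, hX, hcyc⟩
  · exact h1
  exfalso
  have htw : treewidth G ≤ X.card + 1 := Nat.sInf_le (decomp_of_fvs G X hcyc)
  have hle : treewidth G ≤ r * (8 * (2 * (Nat.log 2 r + 1) + 8) + 8) + r + 1 := by omega
  have hleR : (treewidth G : ℝ) ≤ r * (8 * (2 * (Nat.log 2 r + 1) + 8) + 8) + r + 1 := by
    exact_mod_cast hle
  have hr1 : (1 : ℝ) ≤ r := by exact_mod_cast hr
  have hL1 : 1 ≤ Real.logb 2 (r + 1) := by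
    rw [Real.le_logb_iff_rpow_le (by norm_num) (by positivity)]
    norm_num
    linarith
  have hq : (Nat.log 2 r : ℝ) ≤ Real.logb 2 (r + 1) := by
    rw [Real.le_logb_iff_rpow_le (by norm_num) (by positivity), Real.rpow_natCast]
    have : 2 ^ Nat.log 2 r ≤ r := Nat.pow_log_le_self 2 hr.ne'
    have : (2 : ℝ) ^ Nat.log 2 r ≤ r := by exact_mod_cast this
    linarith
  have h5 : (r : ℝ) * (Nat.log 2 r : ℝ) ≤ r * Real.logb 2 (r + 1) := by gcongr
  have h6 : (r : ℝ) * 1 ≤ r * Real.logb 2 (r + 1) := by gcongr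
  nlinarith

end Helpers

/-- There is an absolute constant `c` such that every graph of treewidth at least
`c·r·log₂(r+1)` contains the disjoint union of `r` triangles as a minor. -/
theorem stmt_16 :
    ∃ c : ℝ, 0 < c ∧
      ∀ (r : ℕ), 0 < r →
        ∀ (W V : Type) (_ : Fintype W) (_ : Fintype V)
          (H : SimpleGraph W) (G : SimpleGraph V),
          IsDisjointUnionOfCycles H r 3 → Fintype.card W = 3 * r →
          c * r * Real.logb 2 (r + 1) ≤ (treewidth G : ℝ) →
          IsMinor H G := by
  refine ⟨200, by norm_num, ?_⟩
  intro r hr W V _ _ H G hH _ htw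
  obtain ⟨S, hS, hd⟩ := main_bound G r hr htw
  exact minor_of_cyc H G r hH S hS hd
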